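/- arXiv:2104.10358 — 3 statements merged into one kernel-verified Lean document; each statement's English description precedes it below -/
import Mathlib

section
/- Let Q be a preorder and let the h-preorder on finite Q-labeled forests be defined by F ≤_h F' iff there is a monotone map f : F → F' with c(x) ≤ c'(f(x)) for all x. If Q is a well quasi-order, then the set of finite Q-labeled forests with the h-preorder is a well quasi-order. -/
/-- A well quasi-order: no infinite strictly descending chain and no infinite antichain. -/
def IsWqo {α : Type*} (r : α → α → Prop) : Prop :=
  (¬ ∃ f : ℕ → α, ∀ n : ℕ, r (f (n + 1)) (f n) ∧ ¬ r (f n) (f (n + 1))) ∧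
  (¬ ∃ f : ℕ → α, ∀ m n : ℕ, m ≠ n → ¬ r (f m) (f n))

/-- A finite forest realized as a finite set of nonempty strings over `ℕ`,
closed under nonempty prefixes (so every lower cone is a chain). -/
def IsForest (F : Finset (List ℕ)) : Prop :=
  (∀ s ∈ F, s ≠ []) ∧ ∀ s ∈ F, ∀ t : List ℕ, t <+: s → t ≠ [] → t ∈ F

/-- The h-preorder on `Q`-labeled forests: `(F,c) ≤_h (G,d)` iff there is a monotone
(label-increasing) map from `F` to `G`. -/
def hle {Q : Type*} [Preorder Q] (F : Finset (List ℕ)) (c : List ℕ → Q)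
    (G : Finset (List ℕ)) (d : List ℕ → Q) : Prop :=
  ∃ f : List ℕ → List ℕ, (∀ s ∈ F, f s ∈ G) ∧
    (∀ s ∈ F, ∀ t ∈ F, s <+: t → f s <+: f t) ∧
    (∀ s ∈ F, c s ≤ d (f s))

/-- Finite `Q`-labeled forests. -/
def LForest (Q : Type*) [Preorder Q] := {p : Finset (List ℕ) × (List ℕ → Q) // IsForest p.1}

/-- Elements below and of smaller rank than members of a minimal bad sequence are pwo. -/
theorem aux_pwo {α : Type*} (r : α → α → Prop) [IsPreorder α r] (rk : α → ℕ) (f : ℕ → α)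
    (hf : Set.PartiallyWellOrderedOn.IsBadSeq r Set.univ f)
    (hm : ∀ n, Set.PartiallyWellOrderedOn.IsMinBadSeq r rk Set.univ n f) :
    {x | ∃ n, r x (f n) ∧ rk x < rk (f n)}.PartiallyWellOrderedOn r := by
  classical
  rw [Set.PartiallyWellOrderedOn.iff_forall_not_isBadSeq]
  rintro x ⟨hx, hbad⟩
  choose N hN hrk using hx
  obtain ⟨k, hk⟩ : ∃ k, ∀ j, N k ≤ N j := by
    obtain ⟨k, hk⟩ := Nat.find_spec (⟨N 0, 0, rfl⟩ : ∃ v, ∃ k, N k = v)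
    exact ⟨k, fun j => hk ▸ Nat.find_min' _ ⟨j, rfl⟩⟩
  refine hm (N k) (fun i => if i < N k then f i else x (k + (i - N k)))
    (fun i hi => (if_pos hi).symm) (by simpa using hrk k) ⟨fun _ => trivial, fun i j hij h => ?_⟩
  dsimp only at h
  by_cases hj : j < N k
  · rw [if_pos hj, if_pos (hij.trans hj)] at h
    exact hf.2 i j hij h
  · rw [if_neg hj] at h
    by_cases hi : i < N k
    · rw [if_pos hi] at h
      exact hf.2 i _ (lt_of_lt_of_le hi (hk _)) (_root_.trans h (hN _))
    · rw [if_neg hi] at h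
      exact hbad _ _ (by omega) h

instance hle_isPreorder {Q : Type*} [Preorder Q] :
    IsPreorder (LForest Q) (fun F G : LForest Q => hle F.1.1 F.1.2 G.1.1 G.1.2) where
  refl F := ⟨id, fun _ h => h, fun _ _ _ _ h => h, fun _ _ => le_rfl⟩
  trans F G H := by
    rintro ⟨f, f1, f2, f3⟩ ⟨g, g1, g2, g3⟩
    exact ⟨fun s => g (f s), fun s hs => g1 _ (f1 _ hs),
      fun s hs t ht h => g2 _ (f1 _ hs) _ (f1 _ ht) (f2 _ hs _ ht h),
      fun s hs => (f3 _ hs).trans (g3 _ (f1 _ hs))⟩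

/-- The nodes strictly above the root `[a]`. -/
def subF {Q : Type*} [Preorder Q] (F : LForest Q) (a : ℕ) : LForest Q :=
  ⟨((F.1.1.filter (fun s => s.head? = some a ∧ s.tail ≠ [])).image List.tail,
    fun s => F.1.2 (a :: s)), by
    constructor
    · intro s hs
      simp only [Finset.mem_image, Finset.mem_filter] at hs
      obtain ⟨t, ⟨_, _, h⟩, rfl⟩ := hs
      exact h
    · intro s hs t hts ht
      simp only [Finset.mem_image, Finset.mem_filter] at hs ⊢
      obtain ⟨u, ⟨hu, hh, h⟩, rfl⟩ := hs
      refine ⟨a :: t, ⟨F.2.2 u hu _ ?_ (by simp), by simp, by simpa using ht⟩, rfl⟩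
      cases u with
      | nil => simp at hh
      | cons b u =>
        simp at hh
        subst hh
        simpa [List.cons_prefix_cons] using hts⟩

theorem mem_subF {Q : Type*} [Preorder Q] (F : LForest Q) (a : ℕ) (s : List ℕ) :
    s ∈ (subF F a).1.1 ↔ a :: s ∈ F.1.1 ∧ s ≠ [] := by
  simp only [subF, Finset.mem_image, Finset.mem_filter]
  constructor
  · rintro ⟨u, ⟨hu, hh, h⟩, rfl⟩
    cases u with
    | nil => simp at hh
    | cons b u =>
      simp at hh
      subst hh
      exact ⟨hu, h⟩
  · rintro ⟨h1, h2⟩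
    exact ⟨a :: s, ⟨h1, by simp, by simpa using h2⟩, rfl⟩

/-- The trees not rooted at `[a]`. -/
def restF {Q : Type*} [Preorder Q] (F : LForest Q) (a : ℕ) : LForest Q :=
  ⟨(F.1.1.filter (fun s => s.head? ≠ some a), F.1.2), by
    constructor
    · intro s hs
      exact F.2.1 s (Finset.mem_filter.1 hs).1
    · intro s hs t hts ht
      rw [Finset.mem_filter] at hs ⊢
      refine ⟨F.2.2 s hs.1 t hts ht, ?_⟩
      obtain ⟨u, rfl⟩ := hts
      cases t with
      | nil => exact absurd rfl ht
      | cons b t => simpa using hs.2⟩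

theorem mem_restF {Q : Type*} [Preorder Q] (F : LForest Q) (a : ℕ) (s : List ℕ) :
    s ∈ (restF F a).1.1 ↔ s ∈ F.1.1 ∧ s.head? ≠ some a := by
  simp only [restF, Finset.mem_filter]

theorem exists_root {Q : Type*} [Preorder Q] (F : LForest Q) (h : F.1.1.Nonempty) :
    ∃ a, [a] ∈ F.1.1 := by
  obtain ⟨s, hs⟩ := h
  cases s with
  | nil => exact absurd rfl (F.2.1 _ hs)
  | cons a s => exact ⟨a, F.2.2 _ hs _ (by simp [List.cons_prefix_cons]) (by simp)⟩

theorem card_subF {Q : Type*} [Preorder Q] (F : LForest Q) (a : ℕ) (h : [a] ∈ F.1.1) :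
    (subF F a).1.1.card < F.1.1.card := by
  refine lt_of_le_of_lt Finset.card_image_le (Finset.card_lt_card ?_)
  rw [Finset.filter_ssubset]
  exact ⟨[a], h, by simp⟩

theorem card_restF {Q : Type*} [Preorder Q] (F : LForest Q) (a : ℕ) (h : [a] ∈ F.1.1) :
    (restF F a).1.1.card < F.1.1.card := by
  refine Finset.card_lt_card ?_
  show Finset.filter _ _ ⊂ _
  rw [Finset.filter_ssubset]
  exact ⟨[a], h, by simp⟩

theorem subF_hle {Q : Type*} [Preorder Q] (F : LForest Q) (a : ℕ) :
    hle (subF F a).1.1 (subF F a).1.2 F.1.1 F.1.2 :=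
  ⟨fun s => a :: s, fun s hs => ((mem_subF F a s).1 hs).1,
    fun s _ t _ h => by simpa [List.cons_prefix_cons] using h, fun _ _ => le_rfl⟩

theorem restF_hle {Q : Type*} [Preorder Q] (F : LForest Q) (a : ℕ) :
    hle (restF F a).1.1 (restF F a).1.2 F.1.1 F.1.2 :=
  ⟨id, fun s hs => ((mem_restF F a s).1 hs).1, fun s _ t _ h => h, fun _ _ => le_rfl⟩

theorem combine_hle {Q : Type*} [Preorder Q] (F G : LForest Q) (a b : ℕ)
    (hb : [b] ∈ G.1.1) (hab : F.1.2 [a] ≤ G.1.2 [b])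
    (h1 : hle (subF F a).1.1 (subF F a).1.2 (subF G b).1.1 (subF G b).1.2)
    (h2 : hle (restF F a).1.1 (restF F a).1.2 (restF G b).1.1 (restF G b).1.2) :
    hle F.1.1 F.1.2 G.1.1 G.1.2 := by
  obtain ⟨g, g1, g2, g3⟩ := h1
  obtain ⟨k, k1, k2, k3⟩ := h2
  have hf : ∃ f : List ℕ → List ℕ, f [a] = [b] ∧ (∀ s, s ≠ [] → f (a :: s) = b :: g s) ∧
      ∀ s, s.head? ≠ some a → f s = k s := by
    refine ⟨fun s => if s.head? = some a then (if s.tail = [] then [b] else b :: g s.tail)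
      else k s, by simp, fun s hs => by simp [hs], fun s hs => by simp [hs]⟩
  obtain ⟨f, f1, f2, f3⟩ := hf
  have key : ∀ s ∈ F.1.1, s = [a] ∨ (∃ t, t ∈ (subF F a).1.1 ∧ t ≠ [] ∧ s = a :: t) ∨
      (s ∈ (restF F a).1.1 ∧ s.head? ≠ some a) := by
    intro s hs
    by_cases h : s.head? = some a
    · cases s with
      | nil => simp at h
      | cons c s =>
        simp at h
        subst h
        by_cases h' : s = []
        · left; rw [h']
        · right; left; exact ⟨s, (mem_subF _ _ _).2 ⟨hs, h'⟩, h', rfl⟩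
    · right; right; exact ⟨(mem_restF _ _ _).2 ⟨hs, h⟩, h⟩
  refine ⟨f, ?_, ?_, ?_⟩
  · intro s hs
    rcases key s hs with rfl | ⟨t, ht, ht', rfl⟩ | ⟨h, h'⟩
    · rwa [f1]
    · rw [f2 t ht']; exact ((mem_subF _ _ _).1 (g1 t ht)).1
    · rw [f3 s h']; exact ((mem_restF _ _ _).1 (k1 s h)).1
  · intro s hs t ht hst
    have hhead : s.head? = t.head? := by
      obtain ⟨u, rfl⟩ := hst
      cases s with
      | nil => exact absurd rfl (F.2.1 _ hs)
      | cons c s => simp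
    rcases key s hs with rfl | ⟨s', hs1, hs2, rfl⟩ | ⟨h, h'⟩ <;>
    rcases key t ht with rfl | ⟨t', ht1, ht2, rfl⟩ | ⟨l, l'⟩
    · exact List.prefix_rfl
    · rw [f1, f2 t' ht2]; simp [List.cons_prefix_cons]
    · exact absurd hhead.symm l'
    · simp [List.cons_prefix_cons, hs2] at hst
    · rw [f2 _ hs2, f2 _ ht2]
      rw [List.cons_prefix_cons] at hst ⊢
      exact ⟨rfl, g2 _ hs1 _ ht1 hst.2⟩
    · exact absurd hhead.symm l'
    · exact absurd hhead h'
    · exact absurd hhead h'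
    · rw [f3 _ h', f3 _ l']; exact k2 _ h _ l hst
  · intro s hs
    rcases key s hs with rfl | ⟨t, ht, ht', rfl⟩ | ⟨h, h'⟩
    · rwa [f1]
    · rw [f2 t ht']; exact g3 t ht
    · rw [f3 s h']; exact k3 s h

theorem wqo_of_isWqo {Q : Type*} [Preorder Q]
    (hQ : IsWqo ((· ≤ ·) : Q → Q → Prop)) : WellQuasiOrdered ((· ≤ ·) : Q → Q → Prop) := by
  have : WellQuasiOrderedLE Q := by
    rw [wellQuasiOrderedLE_iff]
    constructor
    · rw [WellFoundedLT, isWellFounded_iff, wellFounded_iff_isEmpty_descending_chain]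
      refine ⟨fun f => hQ.1 ⟨f.1, fun n => ?_⟩⟩
      exact ⟨(f.2 n).le, not_le_of_gt (f.2 n)⟩
    · intro s hs
      by_contra hinf
      have hinf : s.Infinite := hinf
      refine hQ.2 ⟨fun n => hinf.natEmbedding s n, fun m n hmn => ?_⟩
      refine hs (Subtype.coe_prop _) (Subtype.coe_prop _) ?_
      intro h
      exact hmn ((hinf.natEmbedding s).injective (Subtype.ext h))
  exact this.wqo

theorem forest_wqo {Q : Type*} [Preorder Q] (hQ : WellQuasiOrdered ((· ≤ ·) : Q → Q → Prop)) :
    WellQuasiOrdered (fun F G : LForest Q => hle F.1.1 F.1.2 G.1.1 G.1.2) := by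
  rw [← Set.partiallyWellOrderedOn_univ_iff,
    Set.PartiallyWellOrderedOn.iff_not_exists_isMinBadSeq (fun F : LForest Q => F.1.1.card)]
  rintro ⟨f, hf, hm⟩
  have hP := aux_pwo _ _ f hf hm
  have hne : ∀ n, ∃ a, [a] ∈ (f n).1.1 := by
    intro n
    refine exists_root _ ?_
    rw [Finset.nonempty_iff_ne_empty]
    intro h
    refine hf.2 n (n + 1) (Nat.lt_succ_self n) ⟨id, ?_, ?_, ?_⟩ <;> simp [h]
  choose a ha using hne
  obtain ⟨g1, h1⟩ := hQ.exists_monotone_subseq (fun n => (f n).1.2 [a n])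
  obtain ⟨g2, h2⟩ := hP.exists_monotone_subseq (f := fun n => subF (f (g1 n)) (a (g1 n)))
    (fun n => ⟨g1 n, subF_hle _ _, card_subF _ _ (ha _)⟩)
  obtain ⟨m, n, hmn, h3⟩ := hP.exists_lt (f := fun n => restF (f (g1 (g2 n))) (a (g1 (g2 n))))
    (fun n => ⟨g1 (g2 n), restF_hle _ _, card_restF _ _ (ha _)⟩)
  exact hf.2 _ _ (g1.strictMono (g2.strictMono hmn))
    (combine_hle _ _ _ _ (ha _) (h1 _ _ (g2.monotone hmn.le)) (h2 _ _ hmn.le) h3)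

/-- If `Q` is a well quasi-order, then the set of finite `Q`-labeled forests with the
h-preorder is a well quasi-order. -/
theorem stmt5 {Q : Type*} [Preorder Q]
    (hQ : IsWqo ((· ≤ ·) : Q → Q → Prop)) :
    IsWqo (fun F G : LForest Q => hle F.1.1 F.1.2 G.1.1 G.1.2) := by
  have h := forest_wqo (wqo_of_isWqo hQ)
  constructor
  · rintro ⟨f, hf⟩
    obtain ⟨g, hg⟩ := h.exists_monotone_subseq f
    have hdesc : ∀ k n, hle (f (n + k)).1.1 (f (n + k)).1.2 (f n).1.1 (f n).1.2 := by
      intro k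
      induction k with
      | zero => exact fun n => hle_isPreorder.refl (f n)
      | succ k ih => exact fun n => hle_isPreorder.trans _ _ _ (hf (n + k)).1 (ih n)
    have hlt : g 0 < g 1 := g.strictMono Nat.zero_lt_one
    obtain ⟨k, hk⟩ := Nat.exists_eq_add_of_le (Nat.succ_le_of_lt hlt)
    refine (hf (g 0)).2 (hle_isPreorder.trans _ _ _ (hg 0 1 (Nat.zero_le 1)) ?_)
    rw [hk]
    exact hdesc k (g 0 + 1)
  · rintro ⟨f, hf⟩
    obtain ⟨m, n, hmn, hle'⟩ := h f
    exact hf m n hmn.ne hle'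
end

section
/- Let ℳ be a finite automaton and A ⊆ C_ℳ. If A is ≤₁-upward-closed (where c ≤₁ d iff c ⊇ d), then f_ℳ⁻¹(A) is a Σ⁰₂ (F_σ, countable union of closed) subset of X^ω. -/
/-- The run of an automaton on an infinite word. -/
def run {X Q : Type*} (δ : Q → X → Q) (init : Q) (ξ : ℕ → X) : ℕ → Q :=
  fun n => Nat.rec init (fun m q => δ q (ξ m)) n

/-- The set of states occurring infinitely often in the run on `ξ`. -/
def infOcc {X Q : Type*} (δ : Q → X → Q) (init : Q) (ξ : ℕ → X) : Set Q :=
  {q | ∀ N : ℕ, ∃ n : ℕ, N ≤ n ∧ run δ init ξ n = q}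

/-- The set of cycles of the automaton. -/
def cycles {X Q : Type*} (δ : Q → X → Q) (init : Q) : Set (Set Q) :=
  {c | ∃ ξ : ℕ → X, infOcc δ init ξ = c}

theorem run_continuous_aux {X Q : Type*} [TopologicalSpace X] [DiscreteTopology X]
    (δ : Q → X → Q) (init : Q) (n : ℕ) :
    ∀ S : Set Q, IsOpen {ξ : ℕ → X | run δ init ξ n ∈ S} := by
  letI : TopologicalSpace Q := ⊥
  haveI : DiscreteTopology Q := ⟨rfl⟩
  have h : Continuous (fun ξ : ℕ → X => run δ init ξ n) := by
    induction n with
    | zero => exact continuous_const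
    | succ k ih =>
      have h2 : Continuous (fun p : Q × X => δ p.1 p.2) := continuous_of_discreteTopology
      exact h2.comp (ih.prodMk (continuous_apply k))
  intro S
  exact (isOpen_discrete S).preimage h

theorem infOcc_eventually_aux {X Q : Type*} [Finite Q] (δ : Q → X → Q) (init : Q) (ξ : ℕ → X) :
    ∃ N, ∀ n, N ≤ n → run δ init ξ n ∈ infOcc δ init ξ := by
  have h : ∀ q : Q, ∃ N, q ∉ infOcc δ init ξ → ∀ n, N ≤ n → run δ init ξ n ≠ q := by
    intro q
    by_cases hq : q ∈ infOcc δ init ξ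
    · exact ⟨0, fun h => absurd hq h⟩
    · have hq' := hq
      simp only [infOcc, Set.mem_setOf_eq, not_forall, not_exists, not_and] at hq'
      obtain ⟨N, hN⟩ := hq'
      exact ⟨N, fun _ => hN⟩
  choose g hg using h
  obtain ⟨M, hM⟩ := (Set.finite_range g).bddAbove
  refine ⟨M, fun n hn => ?_⟩
  by_contra hc
  exact hg _ hc n ((hM ⟨_, rfl⟩).trans hn) rfl

/-- If `A ⊆ C_ℳ` is `≤₁`-upward-closed (closed under passing to sub-cycles, where
`c ≤₁ d` iff `c ⊇ d`), then `f_ℳ⁻¹(A)` is Σ⁰₂ (F_σ): a countable union of closed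
sets in the Cantor topology on `X^ω`. -/
theorem stmt17 {X Q : Type*} [Finite Q] [TopologicalSpace X] [DiscreteTopology X]
    (δ : Q → X → Q) (init : Q) (A : Set (Set Q))
    (hA : ∀ c ∈ cycles δ init, ∀ d ∈ cycles δ init, c ∈ A → d ⊆ c → d ∈ A) :
    ∃ f : ℕ → Set (ℕ → X), (∀ n, IsClosed (f n)) ∧
      {ξ : ℕ → X | infOcc δ init ξ ∈ A} = ⋃ n, f n := by
  refine ⟨fun N => ⋃ c ∈ A ∩ cycles δ init, {ξ | ∀ n, N ≤ n → run δ init ξ n ∈ c}, ?_, ?_⟩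
  · intro N
    refine Set.Finite.isClosed_biUnion (Set.toFinite _) fun c _ => ?_
    simp only [Set.setOf_forall]
    refine isClosed_iInter fun n => isClosed_iInter fun _ => ?_
    rw [← isOpen_compl_iff]
    exact run_continuous_aux δ init n cᶜ
  · ext ξ
    simp only [Set.mem_setOf_eq, Set.mem_iUnion]
    constructor
    · intro h
      obtain ⟨N, hN⟩ := infOcc_eventually_aux δ init ξ
      exact ⟨N, _, ⟨h, ξ, rfl⟩, hN⟩
    · rintro ⟨N, c, ⟨hc, hc'⟩, h⟩
      refine hA c hc' _ ⟨ξ, rfl⟩ hc ?_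
      intro q hq
      obtain ⟨n, hn, rfl⟩ := hq N
      exact h n hn
end

section
/- Let ℳ be a finite automaton and A ⊆ C_ℳ not ≤₁-upward-closed, i.e., there are cycles c ∈ A and d ∉ A with d ⊆ c. Then the Π⁰₂-complete set {x ∈ {0,1}^ω : x contains infinitely many 1s} continuously reduces to f_ℳ⁻¹(A); in particular f_ℳ⁻¹(A) is not Σ⁰₂. -/
theorem run_succ' {X Q : Type*} (δ : Q → X → Q) (q : Q) (x : ℕ → X) (n : ℕ) :
    run δ q x (n+1) = δ (run δ q x n) (x n) := rfl

theorem run_add' {X Q : Type*} (δ : Q → X → Q) (q : Q) (x : ℕ → X) (m n : ℕ) :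
    run δ q x (m+n) = run δ (run δ q x m) (fun i => x (m+i)) n := by
  induction n with
  | zero => rfl
  | succ n ih => rw [← Nat.add_assoc, run_succ', run_succ', ih]

theorem run_congr' {X Q : Type*} (δ : Q → X → Q) (q : Q) (x y : ℕ → X) (n : ℕ)
    (h : ∀ i < n, x i = y i) : run δ q x n = run δ q y n := by
  induction n with
  | zero => rfl
  | succ n ih =>
    rw [run_succ', run_succ', ih (fun i hi => h i (by omega)), h n (by omega)]

theorem eventually_mem_infOcc {X Q : Type*} [Finite Q] (δ : Q → X → Q) (init : Q) (x : ℕ → X) :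
    ∃ N, ∀ n, N ≤ n → run δ init x n ∈ infOcc δ init x := by
  have h : ∀ q : Q, ∃ N, q ∉ infOcc δ init x → ∀ n, N ≤ n → run δ init x n ≠ q := by
    intro q
    by_cases hq : q ∈ infOcc δ init x
    · exact ⟨0, fun h => absurd hq h⟩
    · have hq' := hq
      simp only [infOcc, Set.mem_ofPred_eq, not_forall] at hq'
      obtain ⟨N, hN⟩ := hq'
      exact ⟨N, fun _ n hn he => hN ⟨n, hn, he⟩⟩
  choose N hN using h
  obtain ⟨M, hM⟩ := (Set.finite_range N).bddAbove
  refine ⟨M, fun n hn => ?_⟩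
  by_contra hc
  exact hN _ hc n ((hM ⟨_, rfl⟩).trans hn) rfl

theorem exists_loop {X Q : Type*} [Finite Q] (δ : Q → X → Q) (init : Q) (x : ℕ → X) (q : Q)
    (hq : q ∈ infOcc δ init x) :
    ∃ (p : ℕ) (w : ℕ → X), 0 < p ∧ (∀ k, run δ q w (k * p) = q) ∧
      (∀ n, run δ q w n ∈ infOcc δ init x) ∧
      ∀ s ∈ infOcc δ init x, ∃ n < p, run δ q w n = s := by
  obtain ⟨N, hN⟩ := eventually_mem_infOcc δ init x
  obtain ⟨a, haN, ha⟩ := hq N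
  have h : ∀ s : Q, ∃ n, s ∈ infOcc δ init x → a ≤ n ∧ run δ init x n = s := by
    intro s
    by_cases hs : s ∈ infOcc δ init x
    · obtain ⟨n, h1, h2⟩ := hs a
      exact ⟨n, fun _ => ⟨h1, h2⟩⟩
    · exact ⟨0, fun h => absurd h hs⟩
  choose t ht using h
  obtain ⟨M, hM⟩ := (Set.finite_range t).bddAbove
  obtain ⟨b, hb, hbq⟩ := hq (M + a + 1)
  obtain ⟨p, rfl⟩ : ∃ p, b = a + p := ⟨b - a, by omega⟩
  have hp : 0 < p := by omega
  have key : ∀ n, run δ q (fun i => x (a + i % p)) n = run δ init x (a + n % p) := by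
    intro n
    induction n with
    | zero => simpa [run] using ha.symm
    | succ n ih =>
      rw [run_succ', ih, ← run_succ' δ init x (a + n % p)]
      have hlt := Nat.mod_lt n hp
      by_cases h : n % p + 1 = p
      · have h0 : (n + 1) % p = 0 := by
          rw [Nat.add_mod, ← Nat.add_mod, ← Nat.mod_add_mod, h, Nat.mod_self]
        rw [h0, Nat.add_assoc, h, hbq, Nat.add_zero, ha]
      · have h0 : (n + 1) % p = n % p + 1 := by
          rw [← Nat.mod_add_mod, Nat.mod_eq_of_lt (by omega)]
        rw [h0, Nat.add_assoc]
  refine ⟨p, fun i => x (a + i % p), hp, fun k => ?_, fun n => ?_, fun s hs => ?_⟩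
  · rw [key, Nat.mul_mod_left, Nat.add_zero, ha]
  · rw [key]; exact hN _ (by omega)
  · obtain ⟨h1, h2⟩ := ht s hs
    have h3 : t s ≤ M := hM ⟨s, rfl⟩
    refine ⟨t s - a, by omega, ?_⟩
    rw [key, Nat.mod_eq_of_lt (by omega), Nat.add_sub_cancel' h1, h2]

theorem exists_reduction {X Q : Type*} [Finite Q] [TopologicalSpace X]
    (δ : Q → X → Q) (init : Q) (A : Set (Set Q)) (c d : Set Q)
    (hc : c ∈ cycles δ init) (hd : d ∈ cycles δ init)
    (hcA : c ∈ A) (hdA : d ∉ A) (hsub : d ⊆ c) :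
    ∃ g : (ℕ → Bool) → (ℕ → X), Continuous g ∧
      ∀ ξ : ℕ → Bool, ((∀ N : ℕ, ∃ n : ℕ, N ≤ n ∧ ξ n = true) ↔
        infOcc δ init (g ξ) ∈ A) := by
  obtain ⟨x, rfl⟩ := hc
  obtain ⟨y, rfl⟩ := hd
  obtain ⟨M, hM⟩ := eventually_mem_infOcc δ init y
  have hqd := hM M le_rfl
  obtain ⟨a, ha⟩ : ∃ a, a = M := ⟨_, rfl⟩
  rw [← ha] at hqd
  obtain ⟨q, hq⟩ : ∃ q, q = run δ init y a := ⟨_, rfl⟩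
  rw [← hq] at hqd
  obtain ⟨p, v, hp, v1, v2, v3⟩ := exists_loop δ init x q (hsub hqd)
  obtain ⟨r, u, hr, u1, u2, u3⟩ := exists_loop δ init y q hqd
  obtain ⟨L, hL⟩ : ∃ L, L = p * r := ⟨_, rfl⟩
  have hL0 : 0 < L := hL ▸ Nat.mul_pos hp hr
  have hpL : p ≤ L := hL ▸ Nat.le_mul_of_pos_right p hr
  have hrL : r ≤ L := hL ▸ Nat.le_mul_of_pos_left r hp
  let g : (ℕ → Bool) → (ℕ → X) := fun ξ n =>
    if n < a then y n else (if ξ ((n - a) / L) then v else u) ((n - a) % L)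
  have gk : ∀ ξ k j, j < L → g ξ (a + k * L + j) = (if ξ k then v else u) j := by
    intro ξ k j hj
    have e : a + k * L + j - a = j + L * k := by rw [Nat.mul_comm L]; omega
    have e1 : (j + L * k) / L = k := by
      rw [Nat.add_mul_div_left _ _ hL0, Nat.div_eq_of_lt hj, Nat.zero_add]
    have e2 : (j + L * k) % L = j := by
      rw [Nat.add_mul_mod_self_left, Nat.mod_eq_of_lt hj]
    have e3 : ¬ (a + k * L + j < a) := by omega
    simp only [g, e, e1, e2, if_neg e3]
  have step : ∀ ξ k, run δ init (g ξ) (a + k * L) = q → ∀ j ≤ L,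
      run δ init (g ξ) (a + k * L + j) = run δ q (if ξ k then v else u) j := by
    intro ξ k h j hj
    rw [run_add', h]
    exact run_congr' _ _ _ _ _ fun i hi => gk ξ k i (by omega)
  have base : ∀ ξ k, run δ init (g ξ) (a + k * L) = q := by
    intro ξ k
    induction k with
    | zero =>
      rw [Nat.zero_mul, Nat.add_zero, hq]
      exact run_congr' _ _ _ _ _ fun i hi => by simp only [g, if_pos hi]
    | succ k ih =>
      rw [Nat.succ_mul, ← Nat.add_assoc, step ξ k ih L le_rfl]
      split_ifs
      · rw [hL, Nat.mul_comm]; exact v1 r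
      · rw [hL]; exact u1 p
  have blk : ∀ ξ n, a ≤ n → run δ init (g ξ) n =
      run δ q (if ξ ((n - a) / L) then v else u) ((n - a) % L) := by
    intro ξ n hn
    rw [← step ξ _ (base ξ _) _ (Nat.mod_lt _ hL0).le]
    congr 1
    have := Nat.div_add_mod' (n - a) L
    omega
  have hge : ∀ k j, k ≤ a + k * L + j := fun k j => by
    have := Nat.le_mul_of_pos_right k hL0
    omega
  refine ⟨g, ?_, fun ξ => ⟨fun h => ?_, fun h => ?_⟩⟩
  · refine continuous_pi fun n => ?_
    by_cases hn : n < a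
    · simp only [g, if_pos hn]; exact continuous_const
    · simp only [g, if_neg hn]
      exact (continuous_of_discreteTopology
        (f := fun b : Bool => (if b then v else u) ((n - a) % L))).comp (continuous_apply _)
  · convert hcA using 1
    ext s
    constructor
    · intro hs
      obtain ⟨n, hn, rfl⟩ := hs a
      rw [blk ξ n hn]
      split_ifs
      · exact v2 _
      · exact hsub (u2 _)
    · intro hs N
      obtain ⟨j, hj, hjs⟩ := v3 s hs
      obtain ⟨k, hk, hξ⟩ := h N
      refine ⟨a + k * L + j, hk.trans (hge k j), ?_⟩
      rw [step ξ k (base ξ k) j (by omega), if_pos hξ, hjs]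
  · by_contra hcon
    push Not at hcon
    obtain ⟨K, hK⟩ := hcon
    apply hdA
    convert h using 1
    ext s
    constructor
    · intro hs N
      obtain ⟨j, hj, hjs⟩ := u3 s hs
      refine ⟨a + (N + K) * L + j, (Nat.le_add_right N K).trans (hge _ j), ?_⟩
      rw [step ξ _ (base ξ _) j (by omega), if_neg (hK _ (by omega)), hjs]
    · intro hs
      obtain ⟨n, hn, rfl⟩ := hs (a + K * L)
      have : K ≤ (n - a) / L := (Nat.le_div_iff_mul_le hL0).2 (by omega)
      rw [blk ξ n (by omega), if_neg (hK _ this)]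
      exact u2 _

theorem dense_of_tail (S : Set (ℕ → Bool)) (b : Bool)
    (h : ∀ (x : ℕ → Bool) (n : ℕ), (fun i => if i < n then x i else b) ∈ S) : Dense S := by
  intro x
  refine mem_closure_of_tendsto (f := fun n : ℕ => fun i => if i < n then x i else b)
    (b := Filter.atTop) ?_ (Filter.Eventually.of_forall (h x))
  refine tendsto_pi_nhds.2 fun i => tendsto_const_nhds.congr' ?_
  filter_upwards [Filter.eventually_gt_atTop i] with n hn
  simp [hn]

theorem infOnes_not_Fsigma (C : ℕ → Set (ℕ → Bool)) (hC : ∀ n, IsClosed (C n))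
    (h : {ξ : ℕ → Bool | ∀ N : ℕ, ∃ n : ℕ, N ≤ n ∧ ξ n = true} = ⋃ n, C n) : False := by
  have g1 : IsGδ {ξ : ℕ → Bool | ∀ N : ℕ, ∃ n : ℕ, N ≤ n ∧ ξ n = true} := by
    rw [Set.ofPred_forall]
    refine IsGδ.iInter_of_isOpen fun N => ?_
    simp only [Set.ofPred_exists]
    refine isOpen_iUnion fun n => ?_
    by_cases hn : N ≤ n
    · simp only [hn, true_and]
      exact (isOpen_discrete ({true} : Set Bool)).preimage
        (continuous_apply (A := fun _ : ℕ => Bool) n)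
    · simp [hn]
  have g2 : IsGδ (⋂ n, (C n)ᶜ) := IsGδ.iInter_of_isOpen fun n => (hC n).isOpen_compl
  rw [← Set.compl_iUnion, ← h] at g2
  have d1 := dense_of_tail {ξ : ℕ → Bool | ∀ N : ℕ, ∃ n : ℕ, N ≤ n ∧ ξ n = true} true
    (fun x n N => ⟨N + n, by omega, by simp⟩)
  have d2 := dense_of_tail {ξ : ℕ → Bool | ∀ N : ℕ, ∃ n : ℕ, N ≤ n ∧ ξ n = true}ᶜ false
    (fun x n hx => by
      obtain ⟨m, hm, he⟩ := hx n
      simp [Nat.not_lt.2 hm] at he)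
  obtain ⟨z, hz1, hz2⟩ := (Dense.inter_of_Gδ g1 g2 d1 d2).nonempty
  exact hz2 hz1

/-- If `A ⊆ C_ℳ` is not `≤₁`-upward-closed (witnessed by cycles `c ∈ A`, `d ∉ A` with
`d ⊆ c`), then the Π⁰₂-complete set `{x ∈ 2^ω : x has infinitely many 1s}`
continuously reduces to `f_ℳ⁻¹(A)`; in particular `f_ℳ⁻¹(A)` is not Σ⁰₂ (not F_σ). -/
theorem stmt19 {X Q : Type*} [Finite Q] [TopologicalSpace X] [DiscreteTopology X]
    (δ : Q → X → Q) (init : Q) (A : Set (Set Q)) (c d : Set Q)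
    (hc : c ∈ cycles δ init) (hd : d ∈ cycles δ init)
    (hcA : c ∈ A) (hdA : d ∉ A) (hsub : d ⊆ c) :
    (∃ g : (ℕ → Bool) → (ℕ → X), Continuous g ∧
      ∀ ξ : ℕ → Bool, ((∀ N : ℕ, ∃ n : ℕ, N ≤ n ∧ ξ n = true) ↔
        infOcc δ init (g ξ) ∈ A)) ∧
    ¬ ∃ f : ℕ → Set (ℕ → X), (∀ n, IsClosed (f n)) ∧
        {ξ : ℕ → X | infOcc δ init ξ ∈ A} = ⋃ n, f n := by
  obtain ⟨g, hg, hred⟩ := exists_reduction δ init A c d hc hd hcA hdA hsub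
  refine ⟨⟨g, hg, hred⟩, ?_⟩
  rintro ⟨f, hf, he⟩
  refine infOnes_not_Fsigma (fun n => g ⁻¹' f n) (fun n => (hf n).preimage hg) ?_
  rw [← Set.preimage_iUnion, ← he]
  ext ξ
  exact hred ξ
end
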